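/- arXiv:1307.6159 — 2 statements merged into one kernel-verified Lean document; each statement's English description precedes it below -/
import Mathlib

section
/- Fix 0 ≤ s < t and H ∈ (1/2, 1). For ε = (ε₁,…,ε_k) ∈ {0,1}^k and τ > 0 define I_k(ε) = ∫ ⋯ ∫ ∏_{j=1}^k |x_j − x_{j+1}|^{H−1} dx₁⋯dx_k where x_{k+1} := x₁ and x_j ranges over [s + ε_j τ, t + ε_j τ]. Then there exists C(s,t) > 0, independent of τ and k, such that I_k(ε) ≤ C(s,t)^k for all k ≥ 2, all ε ∈ {0,1}^k, and all τ > 0. -/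
open MeasureTheory

/-- cyclic successor on `Fin k` -/
def cyc (k : ℕ) (hk : 0 < k) (j : Fin k) : Fin k :=
  ⟨(j.1 + 1) % k, Nat.mod_lt _ hk⟩

lemma pathBound (f : ℝ → ENNReal) (hf : Measurable f) (M L : ENNReal) :
    ∀ (n : ℕ) (μ : Fin (n+1) → Measure ℝ) [∀ i, SigmaFinite (μ i)],
      (∀ i, μ i Set.univ ≤ L) → (∀ i x, ∫⁻ y, f (y - x) ∂(μ i) ≤ M) →
      ∫⁻ x : Fin (n+1) → ℝ, ∏ j : Fin n, f (x j.castSucc - x j.succ) ∂(Measure.pi μ)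
        ≤ M ^ n * L := by
  intro n
  induction n with
  | zero =>
    intro μ _ hL hM
    simp [Measure.pi_univ]
    exact hL 0
  | succ n ih =>
    intro μ _ hL hM
    rw [← ((measurePreserving_piFinSuccAbove μ 0).symm).lintegral_comp (by fun_prop)]
    rw [lintegral_prod_symm _ (by fun_prop)]
    have key : ∀ y : Fin (n+1) → ℝ, ∫⁻ a : ℝ, ∏ j : Fin (n+1),
        f ((MeasurableEquiv.piFinSuccAbove (fun _ => ℝ) 0).symm (a, y) j.castSucc -
          (MeasurableEquiv.piFinSuccAbove (fun _ => ℝ) 0).symm (a, y) j.succ) ∂(μ 0)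
        ≤ M * ∏ j : Fin n, f (y j.castSucc - y j.succ) := by
      intro y
      simp only [MeasurableEquiv.piFinSuccAbove_symm_apply, Fin.insertNthEquiv_zero,
        Fin.prod_univ_succ, Fin.consEquiv_apply, Fin.castSucc_zero, Fin.cons_zero, Fin.cons_succ,
        ← Fin.succ_castSucc]
      rw [lintegral_mul_const _ (by fun_prop)]
      gcongr
      exact hM 0 _
    refine (lintegral_mono key).trans ?_
    rw [lintegral_const_mul _ (by fun_prop), pow_succ', mul_assoc]
    gcongr
    exact ih (fun j => μ (Fin.succAbove 0 j)) (fun i => hL _) (fun i => hM _)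

lemma cycleBound (f : ℝ → ENNReal) (hf : Measurable f) (M L : ENNReal) (n : ℕ)
    (μ : Fin (n+2) → Measure ℝ) [∀ i, SigmaFinite (μ i)]
    (hL : ∀ i, μ i Set.univ ≤ L) (hM : ∀ i x, ∫⁻ y, f (y - x) ∂(μ i) ≤ M)
    (hM2 : ∀ i x z, ∫⁻ y, f (y - x) * f (z - y) ∂(μ i) ≤ M) :
      ∫⁻ x : Fin (n+2) → ℝ, ∏ j : Fin (n+2), f (x j - x (cyc (n+2) (by omega) j)) ∂(Measure.pi μ)
        ≤ M ^ (n+1) * L := by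
  rw [← ((measurePreserving_piFinSuccAbove μ 0).symm).lintegral_comp (by fun_prop)]
  rw [lintegral_prod_symm _ (by fun_prop)]
  have key : ∀ y : Fin (n+1) → ℝ, ∫⁻ a : ℝ, ∏ j : Fin (n+2),
      f ((MeasurableEquiv.piFinSuccAbove (fun _ => ℝ) 0).symm (a, y) j -
        (MeasurableEquiv.piFinSuccAbove (fun _ => ℝ) 0).symm (a, y)
          (cyc (n+2) (by omega) j)) ∂(μ 0)
      ≤ M * ∏ j : Fin n, f (y j.castSucc - y j.succ) := by
    intro y
    have h0 : cyc (n+2) (by omega) 0 = Fin.succ 0 := by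
      ext; simp [cyc]
    have h1 : ∀ i : Fin n, cyc (n+2) (by omega) i.castSucc.succ = i.succ.succ := by
      intro i; ext; simp only [cyc, Fin.val_succ, Fin.val_castSucc]
      exact Nat.mod_eq_of_lt (by omega)
    have h2 : cyc (n+2) (by omega) (Fin.last n).succ = 0 := by
      ext; simp [cyc]
    rw [show (fun a : ℝ => ∏ j : Fin (n+2),
      f ((MeasurableEquiv.piFinSuccAbove (fun _ => ℝ) 0).symm (a, y) j -
        (MeasurableEquiv.piFinSuccAbove (fun _ => ℝ) 0).symm (a, y)
          (cyc (n+2) (by omega) j))) = fun a => (f (a - y 0) * f (y (Fin.last n) - a)) *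
            ∏ j : Fin n, f (y j.castSucc - y j.succ) from ?_]
    · rw [lintegral_mul_const _ (by fun_prop)]
      gcongr
      exact hM2 0 _ _
    · funext a
      rw [Fin.prod_univ_succ, Fin.prod_univ_castSucc]
      simp only [MeasurableEquiv.piFinSuccAbove_symm_apply, Fin.insertNthEquiv_zero,
        h0, h1, h2, Fin.consEquiv_apply, Fin.cons_zero, Fin.cons_succ]
      ring
  refine (lintegral_mono key).trans ?_
  rw [lintegral_const_mul _ (by fun_prop), pow_succ', mul_assoc]
  gcongr
  exact pathBound f hf M L n (fun j => μ (Fin.succAbove 0 j)) (fun i => hL _) (fun i => hM _)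

lemma absInt (p : ℝ) (hp : -1 < p) :
    ∫⁻ u in Set.Icc (-1 : ℝ) 1, ENNReal.ofReal (|u| ^ p) < ⊤ := by
  have h1 : IntervalIntegrable (fun u : ℝ => |u| ^ p) volume 0 1 := by
    refine (intervalIntegral.intervalIntegrable_rpow' (a := 0) (b := 1) hp).congr ?_
    intro u hu
    rw [Set.uIoc_of_le zero_le_one] at hu
    simp only [abs_of_pos hu.1]
  have h2 : IntervalIntegrable (fun u : ℝ => |u| ^ p) volume (-1) 0 := by
    have := (IntervalIntegrable.iff_comp_neg (f := fun u : ℝ => |u| ^ p)).1 h1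
    simpa using this.symm
  have h3 := h2.trans h1
  rw [intervalIntegrable_iff_integrableOn_Icc_of_le (by norm_num)] at h3
  exact h3.lintegral_lt_top

theorem stmt9 (H : ℝ) (hH : H ∈ Set.Ioo (1/2 : ℝ) 1) (s t : ℝ) (hs : 0 ≤ s) (hst : s < t) :
    ∃ C : ℝ, 0 < C ∧ ∀ k : ℕ, ∀ hk : 2 ≤ k, ∀ ε : Fin k → ℝ,
      (∀ j, ε j = 0 ∨ ε j = 1) → ∀ τ : ℝ, 0 < τ →
      ∫ x : Fin k → ℝ in Set.univ.pi fun j => Set.Icc (s + ε j * τ) (t + ε j * τ),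
          ∏ j : Fin k, |x j - x (cyc k (by omega) j)| ^ (H - 1)
        ≤ C ^ k := by
  obtain ⟨hH1, hH2⟩ := hH
  set f : ℝ → ENNReal := fun u => ENNReal.ofReal (|u| ^ (H - 1)) with hfdef
  set q : ℝ → ENNReal := fun u => ENNReal.ofReal (|u| ^ (2 * (H - 1))) with hqdef
  have hf : Measurable f := by fun_prop
  have hq : Measurable q := by fun_prop
  have hsq : ∀ u : ℝ, |u| ^ (2 * (H - 1)) = (|u| ^ (H - 1)) ^ 2 := by
    intro u
    rw [mul_comm, Real.rpow_mul (abs_nonneg _)]; norm_num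
  have hff : ∀ u v, f u * f v ≤ q u + q v := by
    intro u v
    simp only [hfdef, hqdef, hsq]
    rw [← ENNReal.ofReal_mul (by positivity), ← ENNReal.ofReal_add (by positivity) (by positivity)]
    apply ENNReal.ofReal_le_ofReal
    nlinarith [sq_nonneg (|u| ^ (H - 1) - |v| ^ (H - 1)), sq_nonneg (|u| ^ (H - 1)),
      sq_nonneg (|v| ^ (H - 1))]
  have hf1 : ∀ u, f u ≤ q u + 1 := by
    intro u
    simp only [hfdef, hqdef, hsq]
    rw [← ENNReal.ofReal_one, ← ENNReal.ofReal_add (by positivity) (by positivity)]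
    apply ENNReal.ofReal_le_ofReal
    nlinarith [sq_nonneg (|u| ^ (H - 1) - 1), sq_nonneg (|u| ^ (H - 1))]
  have hq1 : ∀ u, q u ≤ (Set.Icc (-1 : ℝ) 1).indicator q u + 1 := by
    intro u
    by_cases hu : u ∈ Set.Icc (-1 : ℝ) 1
    · rw [Set.indicator_of_mem hu]; exact le_self_add
    · rw [Set.indicator_of_notMem hu, zero_add, ← ENNReal.ofReal_one]
      apply ENNReal.ofReal_le_ofReal
      apply Real.rpow_le_one_of_one_le_of_nonpos _ (by linarith)
      by_contra! h
      exact hu (abs_le.1 h.le)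
  set L : ENNReal := ENNReal.ofReal (t - s) with hLdef
  set Q0 : ENNReal := ∫⁻ u in Set.Icc (-1 : ℝ) 1, q u with hQ0
  have hQfin : Q0 < ⊤ := absInt _ (by linarith)
  set Q : ENNReal := Q0 + L with hQ
  have hvol : ∀ c : ℝ, (volume.restrict (Set.Icc (s + c) (t + c))) Set.univ = L := by
    intro c
    simp [hLdef]
  have hqint : ∀ c x : ℝ, ∫⁻ y in Set.Icc (s + c) (t + c), q (y - x) ≤ Q := by
    intro c x
    calc ∫⁻ y in Set.Icc (s + c) (t + c), q (y - x)
        ≤ ∫⁻ y in Set.Icc (s + c) (t + c), ((Set.Icc (-1 : ℝ) 1).indicator q (y - x) + 1) :=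
          lintegral_mono fun y => hq1 _
      _ = (∫⁻ y in Set.Icc (s + c) (t + c), (Set.Icc (-1 : ℝ) 1).indicator q (y - x)) + L := by
          rw [lintegral_add_right _ measurable_const, lintegral_one, hvol]
      _ ≤ (∫⁻ y, (Set.Icc (-1 : ℝ) 1).indicator q (y - x)) + L := by
          gcongr
          exact Measure.restrict_le_self
      _ = Q := by
          rw [lintegral_sub_right_eq_self (fun y => (Set.Icc (-1 : ℝ) 1).indicator q y),
            lintegral_indicator measurableSet_Icc]
  set M : ENNReal := Q + Q with hMdef
  have hLM : L ≤ M := le_add_left le_add_self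
  have hMfin : M ≠ ⊤ := by
    simp [hMdef, hQ, hQfin.ne, hLdef]
  have hM : ∀ c x : ℝ, ∫⁻ y in Set.Icc (s + c) (t + c), f (y - x) ≤ M := by
    intro c x
    refine (lintegral_mono fun y => hf1 _).trans ?_
    rw [lintegral_add_right _ measurable_const, lintegral_one, hvol]
    exact add_le_add (hqint c x) le_add_self
  have hM2 : ∀ c x z : ℝ, ∫⁻ y in Set.Icc (s + c) (t + c), f (y - x) * f (z - y) ≤ M := by
    intro c x z
    refine (lintegral_mono fun y => hff _ _).trans ?_
    rw [lintegral_add_right _ (by fun_prop)]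
    refine add_le_add (hqint c x) ?_
    have : ∀ y, q (z - y) = q (y - z) := fun y => by simp only [hqdef, abs_sub_comm]
    simp only [this]
    exact hqint c z
  refine ⟨M.toReal + 1, by positivity, ?_⟩
  intro k hk ε _ τ _
  obtain ⟨n, rfl⟩ : ∃ n, k = n + 2 := ⟨k - 2, by omega⟩
  have main := cycleBound f hf M L n
    (fun j => volume.restrict (Set.Icc (s + ε j * τ) (t + ε j * τ)))
    (fun j => (hvol _).le) (fun j => hM _) (fun j => hM2 _)
  rw [← Measure.restrict_pi_pi, ← volume_pi] at main
  have h1 := main.trans (show M ^ (n+1) * L ≤ M ^ (n+2) by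
    rw [pow_succ M (n+1)]; gcongr)
  have h2 := (enorm_integral_le_lintegral_enorm (μ := volume.restrict
    (Set.univ.pi fun j => Set.Icc (s + ε j * τ) (t + ε j * τ)))
    (fun x : Fin (n+2) → ℝ => ∏ j, |x j - x (cyc (n+2) (by omega) j)| ^ (H - 1)))
  have h3 : ∀ x : Fin (n+2) → ℝ, ‖∏ j, |x j - x (cyc (n+2) (by omega) j)| ^ (H - 1)‖ₑ
      = ∏ j, f (x j - x (cyc (n+2) (by omega) j)) := by
    intro x
    rw [Real.enorm_of_nonneg (Finset.prod_nonneg fun j _ => by positivity),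
      ENNReal.ofReal_prod_of_nonneg (fun j _ => by positivity)]
  simp only [h3] at h2
  have h4 := h2.trans h1
  rw [← ofReal_norm_eq_enorm, ← ENNReal.ofReal_toReal hMfin,
    ← ENNReal.ofReal_pow ENNReal.toReal_nonneg,
    ENNReal.ofReal_le_ofReal_iff (by positivity)] at h4
  refine (Real.le_norm_self _).trans (h4.trans ?_)
  gcongr
  linarith
end

section
/- Let H ∈ (1/2, 1), fix 0 ≤ s < t, and define, for z₁, z₂ ∈ ℝ and τ > 0, R̃_k(z₁, z₂, τ) = ∫_{ℝ^k} ψ(x₁)⋯ψ(x_k) |x₁−x₂|^{H−1}⋯|x_{k−1}−x_k|^{H−1}|x_k−x₁|^{H−1} dx₁⋯dx_k with ψ = z₁ 1_{(s,t]} + z₂ 1_{(s+τ, t+τ]}. Then there exists C(s,t) > 0, independent of τ, k, z₁, z₂, such that |R̃_k(z₁, z₂, τ)| ≤ (|z₁| + |z₂|)^k C(s,t)^k for all k ≥ 2. -/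
open MeasureTheory

open scoped ENNReal

lemma aux_enorm_prod {n : ℕ} (f : Fin n → ℝ) : ‖∏ j, f j‖ₑ = ∏ j, ‖f j‖ₑ := by
  simp only [enorm_eq_nnnorm, nnnorm_prod, ENNReal.ofNNReal_finsetProd]

lemma aux_cons {n : ℕ} (F : (Fin (n+1) → ℝ) → ℝ≥0∞) (hF : Measurable F) :
    ∫⁻ x, F x = ∫⁻ y : Fin n → ℝ, ∫⁻ a : ℝ, F (Fin.cons a y) := by
  have h := (volume_preserving_piFinSuccAbove (fun _ : Fin (n+1) => ℝ) 0).symm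
  rw [← h.lintegral_comp hF, Measure.volume_eq_prod, lintegral_prod_symm']
  · simp [MeasurableEquiv.piFinSuccAbove, Fin.insertNthEquiv]
  · exact hF.comp (MeasurableEquiv.measurable _)

lemma aux_path (φ : ℝ → ℝ≥0∞) (hφ : Measurable φ) (a : ℝ → ℝ → ℝ≥0∞)
    (ha : Measurable (fun p : ℝ × ℝ => a p.1 p.2)) (K L : ℝ≥0∞)
    (hK : ∀ y, ∫⁻ x, φ x * a x y ≤ K) (hL : ∫⁻ x, φ x ≤ L) (n : ℕ) :
    ∫⁻ x : Fin (n+1) → ℝ, (∏ j, φ (x j)) * ∏ j : Fin n, a (x j.castSucc) (x j.succ)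
      ≤ K ^ n * L := by
  have hm : ∀ n : ℕ, Measurable (fun x : Fin (n+1) → ℝ =>
      (∏ j, φ (x j)) * ∏ j : Fin n, a (x j.castSucc) (x j.succ)) := by
    intro n
    refine Measurable.mul (Finset.measurable_prod _ fun j _ => hφ.comp (measurable_pi_apply j))
      (Finset.measurable_prod _ fun j _ => ?_)
    have h2 : Measurable (fun x : Fin (n+1) → ℝ => (x (j.castSucc), (x j.succ))) := by fun_prop
    exact ha.comp h2
  induction n with
  | zero =>
    rw [aux_cons _ (hm 0)]
    simpa [volume_pi, Measure.pi_univ] using hL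
  | succ n ih =>
    rw [aux_cons _ (hm (n+1))]
    calc _ ≤ ∫⁻ y : Fin (n+1) → ℝ, K *
          ((∏ j, φ (y j)) * ∏ j : Fin n, a (y j.castSucc) (y j.succ)) := by
          refine lintegral_mono fun y => ?_
          have : ∀ b : ℝ, (∏ j, φ ((Fin.cons b y : Fin (n+2) → ℝ) j)) *
              ∏ j : Fin (n+1), a ((Fin.cons b y : Fin (n+2) → ℝ) j.castSucc)
                ((Fin.cons b y : Fin (n+2) → ℝ) j.succ)
              = (φ b * a b (y 0)) *
                ((∏ j, φ (y j)) * ∏ j : Fin n, a (y j.castSucc) (y j.succ)) := by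
            intro b
            rw [Fin.prod_univ_succ, Fin.prod_univ_succ (fun j : Fin (n+1) =>
              a ((Fin.cons b y : Fin (n+2) → ℝ) j.castSucc)
                ((Fin.cons b y : Fin (n+2) → ℝ) j.succ))]
            simp only [Fin.cons_zero, Fin.cons_succ, Fin.castSucc_zero, ← Fin.succ_castSucc]
            ring
          simp_rw [this]
          rw [lintegral_mul_const]
          · gcongr
            exact hK _
          · exact hφ.mul (ha.comp (measurable_id.prodMk measurable_const))
      _ = K * ∫⁻ y : Fin (n+1) → ℝ,
          ((∏ j, φ (y j)) * ∏ j : Fin n, a (y j.castSucc) (y j.succ)) :=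
          lintegral_const_mul _ (hm n)
      _ ≤ K * (K ^ n * L) := by gcongr
      _ = _ := by ring

lemma aux_circ (φ : ℝ → ℝ≥0∞) (hφ : Measurable φ) (a : ℝ → ℝ → ℝ≥0∞)
    (ha : Measurable (fun p : ℝ × ℝ => a p.1 p.2)) (hsymm : ∀ x y, a x y = a y x) (K L : ℝ≥0∞)
    (hK : ∀ y, ∫⁻ x, φ x * a x y ≤ K) (hK2 : ∀ y, ∫⁻ x, φ x * (a x y) ^ 2 ≤ K)
    (hL : ∫⁻ x, φ x ≤ L) (n : ℕ) (h0 : 0 < n + 2) :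
    ∫⁻ x : Fin (n+2) → ℝ, (∏ j, φ (x j)) * ∏ j : Fin (n+2), a (x j) (x (cyc (n+2) h0 j))
      ≤ 2 * K * (K ^ n * L) := by
  have hm1 : Measurable (fun x : Fin (n+1) → ℝ =>
      (∏ j, φ (x j)) * ∏ j : Fin n, a (x j.castSucc) (x j.succ)) := by
    refine Measurable.mul (Finset.measurable_prod _ fun j _ => hφ.comp (measurable_pi_apply j))
      (Finset.measurable_prod _ fun j _ => ?_)
    have h2 : Measurable (fun x : Fin (n+1) → ℝ => (x (j.castSucc), (x j.succ))) := by fun_prop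
    exact ha.comp h2
  have hm : Measurable (fun x : Fin (n+2) → ℝ =>
      (∏ j, φ (x j)) * ∏ j : Fin (n+2), a (x j) (x (cyc (n+2) h0 j))) := by
    refine Measurable.mul (Finset.measurable_prod _ fun j _ => hφ.comp (measurable_pi_apply j))
      (Finset.measurable_prod _ fun j _ => ?_)
    have h2 : Measurable (fun x : Fin (n+2) → ℝ => (x (j), (x (cyc (n+2) h0 j)))) := by fun_prop
    exact ha.comp h2
  have hc1 : ∀ j : Fin (n+1), cyc (n+2) h0 j.castSucc = j.succ := by
    intro j
    ext
    simp only [cyc, Fin.val_castSucc, Fin.val_succ]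
    exact Nat.mod_eq_of_lt (by omega)
  have hc2 : cyc (n+2) h0 (Fin.last (n+1)) = 0 := by
    ext
    simp [cyc]
  have hma : ∀ y, Measurable (fun x => a x y) := fun y =>
    ha.comp (measurable_id.prodMk measurable_const)
  rw [aux_cons _ hm]
  calc _ ≤ ∫⁻ y : Fin (n+1) → ℝ, (2 * K) *
          ((∏ j, φ (y j)) * ∏ j : Fin n, a (y j.castSucc) (y j.succ)) := by
          refine lintegral_mono fun y => ?_
          have : ∀ b : ℝ, (∏ j, φ ((Fin.cons b y : Fin (n+2) → ℝ) j)) *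
              ∏ j : Fin (n+2), a ((Fin.cons b y : Fin (n+2) → ℝ) j)
                ((Fin.cons b y : Fin (n+2) → ℝ) (cyc (n+2) h0 j))
              = (φ b * (a b (y 0) * a b (y (Fin.last n)))) *
                ((∏ j, φ (y j)) * ∏ j : Fin n, a (y j.castSucc) (y j.succ)) := by
            intro b
            rw [Fin.prod_univ_succ, Fin.prod_univ_castSucc (n := n+1), hc2]
            simp only [hc1]
            rw [Fin.prod_univ_succ (fun j : Fin (n+1) =>
              a ((Fin.cons b y : Fin (n+2) → ℝ) j.castSucc)
                ((Fin.cons b y : Fin (n+2) → ℝ) j.succ)), hsymm b (y (Fin.last n))]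
            simp only [Fin.cons_zero, Fin.cons_succ, Fin.castSucc_zero, ← Fin.succ_castSucc,
              ← Fin.succ_last]
            ring
          simp_rw [this]
          rw [lintegral_mul_const]
          · gcongr
            calc _ ≤ ∫⁻ b, (φ b * a b (y 0) ^ 2 + φ b * a b (y (Fin.last n)) ^ 2) := by
                  refine lintegral_mono fun b => ?_
                  dsimp only
                  rw [← mul_add]
                  gcongr
                  rcases le_total (a b (y 0)) (a b (y (Fin.last n))) with h | h
                  · calc _ ≤ a b (y (Fin.last n)) * a b (y (Fin.last n)) := by gcongr
                      _ = a b (y (Fin.last n)) ^ 2 := (sq _).symm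
                      _ ≤ _ := le_add_self
                  · calc _ ≤ a b (y 0) * a b (y 0) := by gcongr
                      _ = a b (y 0) ^ 2 := (sq _).symm
                      _ ≤ _ := le_self_add
              _ = _ := lintegral_add_left (hφ.mul ((hma _).pow_const 2)) _
              _ ≤ K + K := add_le_add (hK2 _) (hK2 _)
              _ = _ := (two_mul K).symm
          · exact hφ.mul ((hma _).mul (hma _))
    _ = 2 * K * ∫⁻ y : Fin (n+1) → ℝ,
          ((∏ j, φ (y j)) * ∏ j : Fin n, a (y j.castSucc) (y j.succ)) :=
          lintegral_const_mul _ hm1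
    _ ≤ _ := by
      gcongr
      exact aux_path φ hφ a ha K L hK hL n

/-- positive part of the kernel near the diagonal -/
noncomputable def auxh (p : ℝ) (u : ℝ) : ℝ≥0∞ :=
  (Set.Ioc (0:ℝ) 1).indicator (fun u => ENNReal.ofReal (u ^ p)) u

lemma auxh_meas (p : ℝ) : Measurable (auxh p) := by
  unfold auxh
  exact Measurable.indicator (by fun_prop) measurableSet_Ioc

lemma auxh_fin (p : ℝ) (hp : -1 < p) : ∫⁻ u, auxh p u ≠ ⊤ := by
  unfold auxh
  rw [lintegral_indicator measurableSet_Ioc]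
  have h := intervalIntegral.intervalIntegrable_rpow' hp (a := 0) (b := 1)
  rw [intervalIntegrable_iff_integrableOn_Ioc_of_le zero_le_one] at h
  exact (Integrable.lintegral_lt_top h).ne

lemma auxh_bound (p : ℝ) (hp : p < 0) (u : ℝ) :
    ENNReal.ofReal (|u| ^ p) ≤ auxh p u + auxh p (-u) + 1 := by
  by_cases h1 : 1 < |u|
  · refine le_trans ?_ le_add_self
    rw [← ENNReal.ofReal_one]
    exact ENNReal.ofReal_le_ofReal (Real.rpow_le_one_of_one_le_of_nonpos h1.le hp.le)
  · push Not at h1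
    refine le_trans ?_ le_self_add
    rcases lt_trichotomy u 0 with h | h | h
    · rw [abs_of_neg h] at h1 ⊢
      refine le_trans ?_ le_add_self
      have : -u ∈ Set.Ioc (0:ℝ) 1 := ⟨by linarith, h1⟩
      simp [auxh, this]
    · subst h
      simp [Real.zero_rpow hp.ne]
    · rw [abs_of_pos h] at h1 ⊢
      refine le_trans ?_ le_self_add
      have : u ∈ Set.Ioc (0:ℝ) 1 := ⟨h, h1⟩
      simp [auxh, this]

lemma aux_ker (p : ℝ) (hp0 : p < 0) (A B : ℝ) (y : ℝ) :
    ∫⁻ x, (Set.Ioc A B).indicator 1 x * ENNReal.ofReal (|x - y| ^ p)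
      ≤ 2 * (∫⁻ u, auxh p u) + ENNReal.ofReal (B - A) := by
  have hm := auxh_meas p
  calc _ ≤ ∫⁻ x, (auxh p (x - y) + auxh p (y - x) +
          (Set.Ioc A B).indicator (1 : ℝ → ℝ≥0∞) x) := by
        refine lintegral_mono fun x => ?_
        have h := auxh_bound p hp0 (x - y)
        rw [neg_sub] at h
        by_cases hx : x ∈ Set.Ioc A B
        · simpa [hx] using h
        · simp [hx]
    _ = _ := by
      rw [lintegral_add_left (by fun_prop), lintegral_add_left (by fun_prop),
        lintegral_sub_right_eq_self (auxh p) y, lintegral_sub_left_eq_self (auxh p) y,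
        lintegral_indicator_one measurableSet_Ioc, Real.volume_Ioc, two_mul]

/-- with `ψ = z₁ 1_{(s,t]} + z₂ 1_{(s+τ,t+τ]}`, the circular integrals
`R̃_k(z₁,z₂,τ) = ∫_{ℝᵏ} ψ(x₁)⋯ψ(x_k) ∏ |x_j − x_{j+1}|^{H−1} dx` satisfy
`|R̃_k| ≤ (|z₁|+|z₂|)^k C(s,t)^k` uniformly in `τ > 0`. -/
theorem stmt17 (H : ℝ) (hH : H ∈ Set.Ioo (1/2 : ℝ) 1) (s t : ℝ) (hs : 0 ≤ s) (hst : s < t) :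
    ∃ C : ℝ, 0 < C ∧ ∀ k : ℕ, ∀ hk : 2 ≤ k, ∀ τ : ℝ, 0 < τ → ∀ z₁ z₂ : ℝ,
      |∫ x : Fin k → ℝ,
          (∏ j : Fin k,
            (z₁ * Set.indicator (Set.Ioc s t) (fun _ => (1:ℝ)) (x j)
              + z₂ * Set.indicator (Set.Ioc (s + τ) (t + τ)) (fun _ => (1:ℝ)) (x j))) *
          ∏ j : Fin k, |x j - x (cyc k (by omega) j)| ^ (H - 1)|
        ≤ (|z₁| + |z₂|) ^ k * C ^ k := by
  obtain ⟨hH1, hH2⟩ := hH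
  set G1 := ∫⁻ u, auxh (H - 1) u with hG1
  set G2 := ∫⁻ u, auxh (2 * (H - 1)) u with hG2
  have hG1f : G1 ≠ ⊤ := auxh_fin _ (by linarith)
  have hG2f : G2 ≠ ⊤ := auxh_fin _ (by linarith)
  set D : ℝ≥0∞ := 2 * (2 * G1 + 2 * G2 + ENNReal.ofReal (t - s)) with hD
  have hDf : D ≠ ⊤ := by
    rw [hD]
    finiteness
  have hDpos : 0 < D := by
    have : 0 < ENNReal.ofReal (t - s) := ENNReal.ofReal_pos.2 (by linarith)
    rw [hD]
    exact ENNReal.mul_pos (by norm_num) (lt_of_lt_of_le this le_add_self).ne'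
  refine ⟨D.toReal, ENNReal.toReal_pos hDpos.ne' hDf, ?_⟩
  intro k hk τ hτ z₁ z₂
  obtain ⟨n, rfl⟩ : ∃ n, k = n + 2 := ⟨k - 2, by omega⟩
  set D' : ℝ≥0∞ := 2 * G1 + 2 * G2 + ENNReal.ofReal (t - s) with hD'
  set w : ℝ≥0∞ := ‖z₁‖ₑ + ‖z₂‖ₑ with hw
  let φ : ℝ → ℝ≥0∞ := fun x => ‖z₁‖ₑ * (Set.Ioc s t).indicator 1 x
    + ‖z₂‖ₑ * (Set.Ioc (s + τ) (t + τ)).indicator 1 x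
  let a : ℝ → ℝ → ℝ≥0∞ := fun x y => ENNReal.ofReal (|x - y| ^ (H - 1))
  have hi : ∀ A B : ℝ, Measurable ((Set.Ioc A B).indicator (1 : ℝ → ℝ≥0∞)) := fun A B =>
    measurable_one.indicator measurableSet_Ioc
  have hφ : Measurable φ := ((hi _ _).const_mul _).add ((hi _ _).const_mul _)
  have ha : Measurable (fun p : ℝ × ℝ => a p.1 p.2) := by
    simp only [a]
    fun_prop
  have hsymm : ∀ x y, a x y = a y x := fun x y => by simp only [a, abs_sub_comm]
  have key : ∀ f : ℝ → ℝ≥0∞, Measurable f →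
      (∀ A B : ℝ, B - A = t - s → ∫⁻ x, (Set.Ioc A B).indicator 1 x * f x ≤ D') →
      ∫⁻ x, φ x * f x ≤ w * D' := by
    intro f hf h
    calc ∫⁻ x, φ x * f x = ∫⁻ x, (‖z₁‖ₑ * ((Set.Ioc s t).indicator 1 x * f x) +
          ‖z₂‖ₑ * ((Set.Ioc (s + τ) (t + τ)).indicator 1 x * f x)) := by
          refine lintegral_congr fun x => ?_
          simp only [φ]
          ring
      _ = ‖z₁‖ₑ * (∫⁻ x, ((Set.Ioc s t).indicator 1 x * f x)) +
          ‖z₂‖ₑ * (∫⁻ x, ((Set.Ioc (s + τ) (t + τ)).indicator 1 x * f x)) := by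
          have hm : ∀ A B : ℝ, Measurable (fun x => (Set.Ioc A B).indicator 1 x * f x) :=
            fun A B => (hi A B).mul hf
          rw [lintegral_add_left ((hm _ _).const_mul _),
            lintegral_const_mul _ (hm _ _), lintegral_const_mul _ (hm _ _)]
      _ ≤ ‖z₁‖ₑ * D' + ‖z₂‖ₑ * D' := by
          gcongr
          · exact h _ _ rfl
          · exact h _ _ (by ring)
      _ = w * D' := by rw [hw, add_mul]
  have hK : ∀ y, ∫⁻ x, φ x * a x y ≤ w * D' := by
    intro y
    refine key (fun x => a x y) (ha.comp (measurable_id.prodMk measurable_const)) ?_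
    intro A B hAB
    refine (aux_ker (H - 1) (by linarith) A B y).trans ?_
    rw [hAB, hD', ← hG1]
    gcongr
    exact le_self_add
  have hK2 : ∀ y, ∫⁻ x, φ x * (a x y) ^ 2 ≤ w * D' := by
    intro y
    refine key (fun x => a x y ^ 2)
      ((ha.comp (measurable_id.prodMk measurable_const)).pow_const 2) ?_
    intro A B hAB
    have e : ∀ x, a x y ^ 2 = ENNReal.ofReal (|x - y| ^ (2 * (H - 1))) := by
      intro x
      simp only [a]
      rw [← ENNReal.ofReal_pow (by positivity), ← Real.rpow_mul_natCast (abs_nonneg _)]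
      congr 2
      push_cast
      ring
    simp_rw [e]
    refine (aux_ker (2 * (H - 1)) (by linarith) A B y).trans ?_
    rw [hAB, hD', ← hG2]
    gcongr
    exact le_add_self
  have hL : ∫⁻ x, φ x ≤ w * D' := by
    have := key (fun _ => 1) measurable_const (by
      intro A B hAB
      simp only [mul_one]
      rw [lintegral_indicator_one measurableSet_Ioc, Real.volume_Ioc, hAB]
      exact le_add_self)
    simpa using this
  have main := aux_circ φ hφ a ha hsymm (w * D') (w * D') hK hK2 hL n (by omega)
  have hle : 2 * (w * D') * ((w * D') ^ n * (w * D')) ≤ (w * D) ^ (n + 2) := by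
    have h1 : w * D' ≤ w * D := by
      rw [hD]
      gcongr
      exact le_mul_of_one_le_left (by simp) (by norm_num)
    calc 2 * (w * D') * ((w * D') ^ n * (w * D')) = (w * D) * ((w * D') ^ n * (w * D')) := by
          rw [hD]; ring
      _ ≤ (w * D) * ((w * D) ^ n * (w * D)) := by gcongr
      _ = _ := by ring
  have hfin := (enorm_integral_le_lintegral_enorm (μ := volume) (fun x : Fin (n+2) → ℝ =>
          (∏ j : Fin (n+2),
            (z₁ * Set.indicator (Set.Ioc s t) (fun _ => (1:ℝ)) (x j)
              + z₂ * Set.indicator (Set.Ioc (s + τ) (t + τ)) (fun _ => (1:ℝ)) (x j))) *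
          ∏ j : Fin (n+2), |x j - x (cyc (n+2) (by omega) j)| ^ (H - 1))).trans
    ((lintegral_mono (fun x => ?_)).trans (main.trans hle))
  · have hwr : (w * D).toReal = (|z₁| + |z₂|) * D.toReal := by
      rw [ENNReal.toReal_mul, hw, ENNReal.toReal_add (by simp) (by simp)]
      simp
    have hwf : (w * D) ^ (n + 2) ≠ ⊤ := by
      rw [hw]
      finiteness
    have := ENNReal.toReal_mono hwf hfin
    rw [ENNReal.toReal_pow, hwr, mul_pow] at this
    simpa using this
  · dsimp only
    rw [enorm_mul, aux_enorm_prod, aux_enorm_prod]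
    gcongr with j _ j _
    · refine (enorm_add_le _ _).trans ?_
      simp only [φ, enorm_mul]
      gcongr
      · by_cases h : x j ∈ Set.Ioc s t <;> simp [h]
      · by_cases h : x j ∈ Set.Ioc (s + τ) (t + τ) <;> simp [h]
    · simp only [a]
      rw [Real.enorm_eq_ofReal (by positivity)]
end
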